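/- arXiv:1703.10498 — 4 statements merged into one kernel-verified Lean document; each statement's English description precedes it below -/
import Mathlib

section
/- Let M be a countable homogeneous structure with the strong small index property and locally finite algebraicity, G = Aut(M), and H₁, H₂ ∈ SS(M). Then the following are equivalent: (1) H₁ is a normal subgroup of H₂ of finite index; (2) there exist K ∈ A(M) and subgroups L₁, L₂ of Aut(K) with L₁ normal in L₂ such that H₁ = G_(K,L₁) and H₂ = G_(K,L₂). -/
open FirstOrder Cardinal

namespace PaperSSIP

variable {L : FirstOrder.Language} {M : Type*} [L.Structure M]

instance autGroup : Group (M ≃[L] M) where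
  mul f g := f.comp g
  one := FirstOrder.Language.Equiv.refl L M
  inv := FirstOrder.Language.Equiv.symm
  mul_assoc f g h := by ext x; rfl
  one_mul f := by ext x; rfl
  mul_one f := by ext x; rfl
  inv_mul_cancel f := by
    ext x
    exact f.symm_apply_apply x

theorem mul_apply (f g : M ≃[L] M) (x : M) : (f * g) x = f (g x) := rfl

theorem one_apply (x : M) : (1 : M ≃[L] M) x = x := rfl

theorem inv_apply (f : M ≃[L] M) (x : M) : f⁻¹ x = f.symm x := rfl

/-- The pointwise stabilizer of a set. -/
def ptStab (L : FirstOrder.Language) {M : Type*} [L.Structure M] (A : Set M) :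
    Subgroup (M ≃[L] M) where
  carrier := {g | ∀ a ∈ A, g a = a}
  one_mem' := fun a _ => rfl
  mul_mem' := by
    intro f g hf hg a ha
    rw [mul_apply, hg a ha, hf a ha]
  inv_mem' := by
    intro f hf a ha
    rw [inv_apply]
    conv_lhs => rw [← hf a ha]
    exact f.symm_apply_apply a

/-- The setwise stabilizer of a set. -/
def setStab (L : FirstOrder.Language) {M : Type*} [L.Structure M] (A : Set M) :
    Subgroup (M ≃[L] M) where
  carrier := {g | g '' A = A}
  one_mem' := by
    have : ⇑(1 : M ≃[L] M) = id := funext fun x => rfl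
    simp only [Set.mem_setOf_eq, this, Set.image_id]
  mul_mem' := by
    intro f g hf hg
    have : ⇑(f * g) = ⇑f ∘ ⇑g := rfl
    simp only [Set.mem_setOf_eq] at *
    rw [this, Set.image_comp, hg, hf]
  inv_mem' := by
    intro f hf
    have h1 : ⇑f⁻¹ ∘ ⇑f = id := funext fun x => f.symm_apply_apply x
    simp only [Set.mem_setOf_eq] at *
    calc ⇑f⁻¹ '' A = ⇑f⁻¹ '' (⇑f '' A) := by rw [hf]
    _ = A := by rw [← Set.image_comp, h1, Set.image_id]

/-- The orbit of a point under a subgroup of the automorphism group. -/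
def orbit (H : Subgroup (M ≃[L] M)) (a : M) : Set M := {b | ∃ g ∈ H, g a = b}

/-- The algebraic closure of a set: points with finite orbit under the pointwise
stabilizer of the set. -/
def acl (L : FirstOrder.Language) {M : Type*} [L.Structure M] (A : Set M) : Set M :=
  {a | (orbit (ptStab L A) a).Finite}

/-- A subgroup has small index if its index is less than the continuum. -/
def SmallIndex (H : Subgroup (M ≃[L] M)) : Prop := #((M ≃[L] M) ⧸ H) < continuum

/-- The strong small index property. -/
def HasSSIP (L : FirstOrder.Language) (M : Type*) [L.Structure M] : Prop :=
  ∀ H : Subgroup (M ≃[L] M), SmallIndex H →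
    ∃ A : Set M, A.Finite ∧ ptStab L A ≤ H ∧ H ≤ setStab L A

/-- Locally finite algebraicity. -/
def LocFinAlg (L : FirstOrder.Language) (M : Type*) [L.Structure M] : Prop :=
  ∀ A : Set M, A.Finite → (acl L A).Finite

/-- Membership in `𝐀(M)`: being (the substructure carried by) the algebraic closure
of a finite set. -/
def memA (L : FirstOrder.Language) {M : Type*} [L.Structure M]
    (S : L.Substructure M) : Prop :=
  ∃ B : Set M, B.Finite ∧ (S : Set M) = acl L B

/-- `G_(K, L')`: automorphisms of `M` whose restriction to `K` lies in `L'`. -/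
def stabIn (S : L.Substructure M) (L' : Subgroup (↥S ≃[L] ↥S)) :
    Subgroup (M ≃[L] M) where
  carrier := {f | ∃ e ∈ L', ∀ x : S, f (x : M) = (e x : M)}
  one_mem' := ⟨1, L'.one_mem, fun _ => rfl⟩
  mul_mem' := by
    rintro f g ⟨ef, hef, hf⟩ ⟨eg, heg, hg⟩
    refine ⟨ef * eg, mul_mem hef heg, fun x => ?_⟩
    rw [mul_apply, hg x]
    exact hf (eg x)
  inv_mem' := by
    rintro f ⟨e, he, hfe⟩
    refine ⟨e⁻¹, inv_mem he, fun x => ?_⟩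
    have h1 : f ((e⁻¹ x : S) : M) = (x : M) := by
      rw [hfe (e⁻¹ x)]
      exact congrArg _ (e.apply_symm_apply x)
    have h2 : f (f⁻¹ (x : M)) = (x : M) := f.apply_symm_apply x
    exact EquivLike.injective f (h2.trans h1.symm)

/-- The family `𝒮𝒮(M)` of subgroups of the form `G_(K, L')`. -/
def SS (L : FirstOrder.Language) (M : Type*) [L.Structure M] :
    Set (Subgroup (M ≃[L] M)) :=
  {H | ∃ (S : L.Substructure M) (L' : Subgroup (↥S ≃[L] ↥S)), memA L S ∧ H = stabIn S L'}

/-- The family `𝒫𝒮(M)` of pointwise stabilizers of members of `𝐀(M)`. -/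
def PS (L : FirstOrder.Language) (M : Type*) [L.Structure M] :
    Set (Subgroup (M ≃[L] M)) :=
  {H | ∃ S : L.Substructure M, memA L S ∧ H = ptStab L (S : Set M)}

theorem finite_orbit_of_finiteIndex {H P : Subgroup (M ≃[L] M)}
    (hHP : (H.subgroupOf P).FiniteIndex) {a : M} (ha : (orbit H a).Finite) :
    (orbit P a).Finite := by
  refine (Set.finite_iUnion fun q : P ⧸ H.subgroupOf P =>
    ha.image (q.out : M ≃[L] M)).subset ?_
  rintro _ ⟨g, hg, rfl⟩
  obtain ⟨h, hh⟩ := QuotientGroup.mk_out_eq_mul (H.subgroupOf P) ⟨g, hg⟩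
  refine Set.mem_iUnion.2 ⟨QuotientGroup.mk ⟨g, hg⟩, ((h : P) : M ≃[L] M)⁻¹ a, ?_, ?_⟩
  · exact ⟨_, inv_mem (Subgroup.mem_subgroupOf.1 h.2), rfl⟩
  · rw [hh, ← mul_apply, Subgroup.coe_mul, mul_inv_cancel_right]

theorem orbit_mono {H P : Subgroup (M ≃[L] M)} (h : H ≤ P) (a : M) : orbit H a ⊆ orbit P a :=
  fun _ ⟨g, hg, hga⟩ => ⟨g, h hg, hga⟩

/-- If `P` preserves the finite set `K`, then the pointwise stabilizer of `K` has finite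
index in `P`. -/
theorem finiteIndex_ptStab_subgroupOf {P : Subgroup (M ≃[L] M)} {K : Set M} (hK : K.Finite)
    (hP : ∀ g ∈ P, ∀ a ∈ K, g a ∈ K) : ((ptStab L K).subgroupOf P).FiniteIndex := by
  have := hK.to_subtype
  let F : P ⧸ (ptStab L K).subgroupOf P → (K → K) :=
    fun q a => ⟨(q.out : M ≃[L] M) a, hP _ q.out.2 _ a.2⟩
  have hF : Function.Injective F := by
    intro p q hpq
    rw [← p.out_eq', ← q.out_eq']
    refine QuotientGroup.eq.2 (Subgroup.mem_subgroupOf.2 fun a ha => ?_)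
    have h : (p.out : M ≃[L] M) a = (q.out : M ≃[L] M) a :=
      congrArg Subtype.val (congrFun hpq ⟨a, ha⟩)
    change (p.out : M ≃[L] M).symm ((q.out : M ≃[L] M) a) = a
    rw [← h]
    exact (p.out : M ≃[L] M).symm_apply_apply a
  have := Finite.of_injective F hF
  exact Subgroup.finiteIndex_of_finite_quotient

theorem acl_acl (hlf : LocFinAlg L M) {B : Set M} (hB : B.Finite) :
    acl L (acl L B) ⊆ acl L B := by
  intro a ha
  refine finite_orbit_of_finiteIndex (finiteIndex_ptStab_subgroupOf (hlf B hB) ?_) ha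
  intro g hg b hb
  refine Set.Finite.subset hb ?_
  rintro _ ⟨h, hh, rfl⟩
  exact ⟨h * g, mul_mem hh hg, rfl⟩

theorem memA.finite (hlf : LocFinAlg L M) {S : L.Substructure M} (hS : memA L S) :
    (S : Set M).Finite := by
  obtain ⟨B, hB, h⟩ := hS
  exact h ▸ hlf B hB

theorem memA.acl_subset (hlf : LocFinAlg L M) {S : L.Substructure M} (hS : memA L S) :
    acl L (S : Set M) ⊆ S := by
  obtain ⟨B, hB, h⟩ := hS
  exact h ▸ acl_acl hlf hB

theorem ptStab_le_stabIn (S : L.Substructure M) (N : Subgroup (S ≃[L] S)) :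
    ptStab L (S : Set M) ≤ stabIn S N :=
  fun _ hf => ⟨1, one_mem _, fun x => hf x x.2⟩

theorem apply_mem_of_mem_stabIn {S : L.Substructure M} {N : Subgroup (S ≃[L] S)}
    {f : M ≃[L] M} (hf : f ∈ stabIn S N) {a : M} (ha : a ∈ S) : f a ∈ S := by
  obtain ⟨e, -, h⟩ := hf
  exact (h ⟨a, ha⟩).symm ▸ (e ⟨a, ha⟩).2

theorem orbit_stabIn_subset {S : L.Substructure M} {N : Subgroup (S ≃[L] S)} {a : M}
    (ha : a ∈ S) : orbit (stabIn S N) a ⊆ S := by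
  rintro _ ⟨g, hg, rfl⟩
  exact apply_mem_of_mem_stabIn hg ha

/-- An automorphism of `M` extending `e` lies in `stabIn S N` exactly when `e ∈ N`. -/
theorem mem_stabIn_iff {S : L.Substructure M} {N : Subgroup (S ≃[L] S)} {f : M ≃[L] M}
    {e : S ≃[L] S} (hfe : ∀ x : S, f x = e x) : f ∈ stabIn S N ↔ e ∈ N := by
  refine ⟨?_, fun he => ⟨e, he, hfe⟩⟩
  rintro ⟨e', he', h⟩
  have : e = e' := by
    ext x
    exact (hfe x).symm.trans (h x)
  exact this ▸ he'

theorem exists_extension (hhom : L.IsUltrahomogeneous M) {S : L.Substructure M}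
    (hS : (S : Set M).Finite) (e : S ≃[L] S) : ∃ f : M ≃[L] M, ∀ x : S, f x = e x := by
  have hfg : S.FG := FirstOrder.Language.Substructure.fg_def.2 ⟨S, hS, S.closure_eq⟩
  obtain ⟨g, hg⟩ := hhom S hfg (S.subtype.comp e.toEmbedding)
  exact ⟨g, fun x => (DFunLike.congr_fun hg x).symm⟩

/-- If `stabIn S₁ N₁` is a finite-index subgroup of `stabIn S₂ N₂`, then `S₁ = S₂`. -/
theorem eq_of_stabIn_finiteIndex (hlf : LocFinAlg L M) {S₁ S₂ : L.Substructure M}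
    (hS₁ : memA L S₁) (hS₂ : memA L S₂) {N₁ : Subgroup (S₁ ≃[L] S₁)}
    {N₂ : Subgroup (S₂ ≃[L] S₂)} (hle : stabIn S₁ N₁ ≤ stabIn S₂ N₂)
    (hfin : ((stabIn S₁ N₁).subgroupOf (stabIn S₂ N₂)).FiniteIndex) : S₁ = S₂ := by
  apply le_antisymm
  · intro a ha
    exact hS₂.acl_subset hlf <|
      (finite_orbit_of_finiteIndex hfin
        ((hS₁.finite hlf).subset (orbit_stabIn_subset ha))).subset
      (orbit_mono (ptStab_le_stabIn S₂ N₂) a)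
  · intro a ha
    exact hS₁.acl_subset hlf <|
      (hS₂.finite hlf).subset <|
      (orbit_mono ((ptStab_le_stabIn S₁ N₁).trans hle) a).trans (orbit_stabIn_subset ha)

theorem conj_extends {S : L.Substructure M} {f g : M ≃[L] M} {e n : S ≃[L] S}
    (hf : ∀ x : S, f x = e x) (hg : ∀ x : S, g x = n x) (x : S) :
    (f * g * f⁻¹) x = ((e * n * e⁻¹) x : S) := by
  have h : f⁻¹ (x : M) = (e⁻¹ x : S) := by
    refine f.injective ((f.apply_symm_apply (x : M)).trans ?_)
    rw [hf]
    exact congrArg Subtype.val (e.apply_symm_apply x).symm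
  simp only [mul_apply, h, hg, hf]

/-- For `H₁, H₂ ∈ 𝒮𝒮(M)`: `H₁` is a normal subgroup of finite index of `H₂`
iff there are `K ∈ 𝐀(M)` and `L₁ ⊴ L₂ ≤ Aut(K)` with `Hᵢ = G_(K,Lᵢ)`. -/
theorem statement_6 {L : FirstOrder.Language} {M : Type*} [L.Structure M]
    [Countable M] [Countable L.Symbols]
    (hhom : L.IsUltrahomogeneous M) (hssip : HasSSIP L M) (hlf : LocFinAlg L M)
    {H₁ H₂ : Subgroup (M ≃[L] M)} (h₁ : H₁ ∈ SS L M) (h₂ : H₂ ∈ SS L M) :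
    (H₁ ≤ H₂ ∧ (H₁.subgroupOf H₂).Normal ∧ (H₁.subgroupOf H₂).FiniteIndex) ↔
      ∃ (S : L.Substructure M) (L₁ L₂ : Subgroup (↥S ≃[L] ↥S)),
        memA L S ∧ L₁ ≤ L₂ ∧ (L₁.subgroupOf L₂).Normal ∧
          H₁ = stabIn S L₁ ∧ H₂ = stabIn S L₂ := by
  constructor
  · rintro ⟨hle, hnorm, hfin⟩
    obtain ⟨S, N₁, hS, rfl⟩ := h₁
    obtain ⟨S₂, N₂, hS₂, rfl⟩ := h₂
    obtain rfl := eq_of_stabIn_finiteIndex hlf hS hS₂ hle hfin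
    refine ⟨S, N₁, N₂, hS, fun e he => ?_, ⟨?_⟩, rfl, rfl⟩
    · obtain ⟨f, hf⟩ := exists_extension hhom (hS.finite hlf) e
      exact (mem_stabIn_iff hf).1 (hle ((mem_stabIn_iff hf).2 he))
    · rintro ⟨n, hn₂⟩ hn ⟨e, he⟩
      rw [Subgroup.mem_subgroupOf] at hn ⊢
      obtain ⟨f, hf⟩ := exists_extension hhom (hS.finite hlf) e
      obtain ⟨g, hg⟩ := exists_extension hhom (hS.finite hlf) n
      have hconj := hnorm.conj_mem ⟨g, (mem_stabIn_iff hg).2 hn₂⟩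
        (Subgroup.mem_subgroupOf.2 ((mem_stabIn_iff hg).2 hn)) ⟨f, (mem_stabIn_iff hf).2 he⟩
      exact (mem_stabIn_iff (conj_extends hf hg)).1 (Subgroup.mem_subgroupOf.1 hconj)
  · rintro ⟨S, N₁, N₂, hS, hle, hnorm, rfl, rfl⟩
    refine ⟨fun f ⟨e, he, h⟩ => ⟨e, hle he, h⟩, ⟨?_⟩, ?_⟩
    · rintro ⟨g, hg₂⟩ hg ⟨f, hf⟩
      rw [Subgroup.mem_subgroupOf] at hg ⊢
      obtain ⟨n, hn, hgn⟩ := hg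
      obtain ⟨e, he, hfe⟩ := hf
      have hconj := hnorm.conj_mem ⟨n, hle hn⟩ (Subgroup.mem_subgroupOf.2 hn) ⟨e, he⟩
      exact (mem_stabIn_iff (conj_extends hfe hgn)).2 (Subgroup.mem_subgroupOf.1 hconj)
    · have := finiteIndex_ptStab_subgroupOf (P := stabIn S N₂) (hS.finite hlf)
        fun g hg a ha => apply_mem_of_mem_stabIn hg ha
      exact Subgroup.finiteIndex_of_le (Subgroup.subgroupOf_mono _ (ptStab_le_stabIn S N₁))

end PaperSSIP
end

section
/- Let M be a countable homogeneous structure with the strong small index property and locally finite algebraicity, and G = Aut(M). Then every abstract group automorphism F of G maps the family PS(M) of pointwise stabilizers of members of A(M) onto itself: for every subgroup H of G, H ∈ PS(M) if and only if F(H) ∈ PS(M). -/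
open FirstOrder Cardinal

namespace PaperSSIP

variable {L : FirstOrder.Language} {M : Type*} [L.Structure M]

/-- The natural action of the automorphism group on the structure. -/
instance autMulAction : MulAction (M ≃[L] M) M where
  smul g x := g x
  one_smul _ := rfl
  mul_smul _ _ _ := rfl

theorem finite_orbit_iff_relIndex_ne_zero (H : Subgroup (M ≃[L] M)) (a : M) :
    (orbit H a).Finite ↔ (ptStab L {a}).relIndex H ≠ 0 := by
  have h1 : (ptStab L {a}).subgroupOf H = MulAction.stabilizer H a := by
    ext g
    simp only [Subgroup.mem_subgroupOf, MulAction.mem_stabilizer_iff]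
    exact ⟨fun h => h a rfl, fun h b hb => by rw [Set.mem_singleton_iff.1 hb]; exact h⟩
  have h2 : orbit H a = MulAction.orbit H a := by
    ext b
    exact ⟨fun ⟨g, hg, h⟩ => ⟨⟨g, hg⟩, h⟩, fun ⟨g, h⟩ => ⟨g, g.2, h⟩⟩
  rw [Subgroup.relIndex, h1, MulAction.index_stabilizer, h2]
  refine ⟨fun h => ?_, Set.finite_of_ncard_ne_zero⟩
  exact ((Set.ncard_pos h).2 (MulAction.nonempty_orbit a)).ne'

theorem relIndex_ptStab_ne_zero {A : Set M} (hA : A.Finite) {H : Subgroup (M ≃[L] M)}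
    (h : ∀ a ∈ A, (orbit H a).Finite) : (ptStab L A).relIndex H ≠ 0 := by
  have := hA.to_subtype
  have h1 : ptStab L A = ⨅ a : A, ptStab L {(a : M)} := by
    ext g
    simp only [Subgroup.mem_iInf]
    exact ⟨fun hg a b hb => hg b (by rw [Set.mem_singleton_iff.1 hb]; exact a.2),
      fun hg a ha => hg ⟨a, ha⟩ a rfl⟩
  rw [h1]
  exact Subgroup.relIndex_iInf_ne_zero fun a =>
    (finite_orbit_iff_relIndex_ne_zero H _).1 (h a a.2)

theorem finite_orbit_of_relIndex_ne_zero {H K : Subgroup (M ≃[L] M)}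
    (hHK : H.relIndex K ≠ 0) {a : M} (h : (orbit H a).Finite) : (orbit K a).Finite := by
  rw [finite_orbit_iff_relIndex_ne_zero] at h ⊢
  exact Subgroup.relIndex_ne_zero_trans h hHK

theorem ptStab_anti {A B : Set M} (h : A ⊆ B) : ptStab L B ≤ ptStab L A :=
  fun _ hg a ha => hg a (h ha)

theorem subset_acl (A : Set M) : A ⊆ acl L A := fun a ha =>
  (Set.finite_singleton a).subset fun _ ⟨_, hg, h⟩ => h.symm.trans (hg a ha)

theorem relIndex_ptStab_acl_ne_zero {A : Set M} (hA : (acl L A).Finite) :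
    (ptStab L (acl L A)).relIndex (ptStab L A) ≠ 0 :=
  relIndex_ptStab_ne_zero hA fun _ ha => ha

theorem acl_acl_subset {A : Set M} (hA : (acl L A).Finite) : acl L (acl L A) ⊆ acl L A :=
  fun _ ha => finite_orbit_of_relIndex_ne_zero (relIndex_ptStab_acl_ne_zero hA) ha

/-- The algebraic closure of a set, as a substructure. -/
def aclSubstructure (A : Set M) : L.Substructure M where
  carrier := acl L A
  fun_mem := fun {n} f x hx => by
    refine ((Set.Finite.pi' hx).image (FirstOrder.Language.Structure.funMap f)).subset ?_
    rintro _ ⟨g, hg, rfl⟩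
    exact ⟨g ∘ x, fun i => ⟨g, hg, rfl⟩, (g.map_fun f x).symm⟩

theorem smallIndex_ptStab [Countable M] {A : Set M} (hA : A.Finite) :
    SmallIndex (ptStab L A) := by
  have := hA.to_subtype
  have hinj : Function.Injective
      (fun q : (M ≃[L] M) ⧸ ptStab L A => fun a : A => q.out (a : M)) := by
    intro p q h
    rw [← p.out_eq', ← q.out_eq', QuotientGroup.eq]
    intro a ha
    have h1 : p.out a = q.out a := congrFun h ⟨a, ha⟩
    rw [mul_apply, ← h1, inv_apply]
    exact p.out.symm_apply_apply a
  have := hinj.countable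
  exact (Cardinal.mk_le_aleph0).trans_lt Cardinal.aleph0_lt_continuum

theorem finite_orbit_of_le_setStab {A : Set M} (hA : A.Finite) {H : Subgroup (M ≃[L] M)}
    (h : H ≤ setStab L A) {a : M} (ha : a ∈ A) : (orbit H a).Finite := by
  refine hA.subset ?_
  rintro _ ⟨g, hg, rfl⟩
  have h1 : g '' A = A := h hg
  exact h1 ▸ Set.mem_image_of_mem g ha

/-- Pointwise stabilizers of algebraically closed finite sets are the subgroups of small index
without proper subgroups of small index and finite relative index. -/
theorem mem_PS_iff [Countable M] (hssip : HasSSIP L M) (hlf : LocFinAlg L M)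
    (H : Subgroup (M ≃[L] M)) :
    H ∈ PS L M ↔ SmallIndex H ∧
      ∀ K ≤ H, SmallIndex K → K.relIndex H ≠ 0 → H ≤ K := by
  constructor
  · rintro ⟨S, ⟨B, hB, hS⟩, rfl⟩
    rw [hS]
    have hfin := hlf B hB
    refine ⟨smallIndex_ptStab hfin, fun K _ hK hrel => ?_⟩
    obtain ⟨A, hA, hAK, hKA⟩ := hssip K hK
    refine le_trans (ptStab_anti fun a ha => acl_acl_subset hfin ?_) hAK
    exact finite_orbit_of_relIndex_ne_zero hrel (finite_orbit_of_le_setStab hA hKA ha)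
  · rintro ⟨hH, hmin⟩
    obtain ⟨A, hA, hAH, hHA⟩ := hssip H hH
    have hrel : (ptStab L A).relIndex H ≠ 0 :=
      relIndex_ptStab_ne_zero hA fun _ ha => finite_orbit_of_le_setStab hA hHA ha
    have hle : ptStab L (acl L A) ≤ H := (ptStab_anti (subset_acl A)).trans hAH
    refine ⟨aclSubstructure A, ⟨A, hA, rfl⟩, le_antisymm ?_ hle⟩
    exact hmin _ hle (smallIndex_ptStab (hlf A hA))
      (Subgroup.relIndex_ne_zero_trans (relIndex_ptStab_acl_ne_zero (hlf A hA)) hrel)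

theorem SmallIndex.map {H : Subgroup (M ≃[L] M)} (hH : SmallIndex H)
    (F : MulAut (M ≃[L] M)) : SmallIndex (H.map F.toMonoidHom) := by
  refine lt_of_le_of_lt (Cardinal.mk_le_of_surjective
    (f := Quotient.map' (s₁ := QuotientGroup.leftRel H) F fun a b h => ?_) ?_) hH
  · rw [QuotientGroup.leftRel_apply] at h ⊢
    exact ⟨_, h, by simp⟩
  · intro q
    induction q using Quotient.inductionOn' with
    | h g => exact ⟨Quotient.mk'' (F.symm g), congrArg Quotient.mk'' (F.apply_symm_apply g)⟩

theorem map_mem_PS [Countable M] (hssip : HasSSIP L M) (hlf : LocFinAlg L M)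
    (F : MulAut (M ≃[L] M)) {H : Subgroup (M ≃[L] M)} (h : H ∈ PS L M) :
    H.map F.toMonoidHom ∈ PS L M := by
  rw [mem_PS_iff hssip hlf] at h ⊢
  refine ⟨h.1.map F, fun K hK hKs hrel => ?_⟩
  have hK' : (K.map F.symm.toMonoidHom).map F.toMonoidHom = K := by
    rw [Subgroup.map_map]
    convert Subgroup.map_id K
    ext1 g
    exact F.apply_symm_apply g
  rw [← hK'] at hK hrel ⊢
  rw [Subgroup.relIndex_map_map_of_injective _ _ F.injective] at hrel
  exact Subgroup.map_mono
    (h.2 _ ((Subgroup.map_le_map_iff_of_injective F.injective).1 hK) (hKs.map F.symm) hrel)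

/-- Every abstract group automorphism of `Aut(M)` maps `𝒫𝒮(M)` onto itself. -/
theorem statement_11 {L : FirstOrder.Language} {M : Type*} [L.Structure M]
    [Countable M] [Countable L.Symbols]
    (hhom : L.IsUltrahomogeneous M) (hssip : HasSSIP L M) (hlf : LocFinAlg L M)
    (F : MulAut (M ≃[L] M)) (H : Subgroup (M ≃[L] M)) :
    H ∈ PS L M ↔ H.map F.toMonoidHom ∈ PS L M := by
  refine ⟨map_mem_PS hssip hlf F, fun h => ?_⟩
  have h' := map_mem_PS hssip hlf F.symm h
  rw [Subgroup.map_map] at h'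
  convert h'
  symm
  convert Subgroup.map_id H
  ext1 g
  exact F.symm_apply_apply g

end PaperSSIP
end

section
/- Let M and N be structures such that in N distinct points have distinct point stabilizers (i.e. the map b ↦ Aut(N)_(b) is injective on N). Suppose F : Aut(M) → Aut(N) is a group isomorphism and f : M → N is a bijection such that F maps Aut(M)_(a) onto Aut(N)_(f(a)) for every a ∈ M. Then F(h) = f ∘ h ∘ f⁻¹ for every h ∈ Aut(M). -/
open FirstOrder Cardinal

namespace PaperSSIP

variable {L : FirstOrder.Language} {M : Type*} [L.Structure M]

theorem mem_ptStab_singleton {g : M ≃[L] M} {a : M} :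
    g ∈ ptStab L ({a} : Set M) ↔ g a = a := by
  change (∀ b ∈ ({a} : Set M), g b = b) ↔ _
  simp only [Set.mem_singleton_iff, forall_eq]

/-- The stabilizer of a translated point is the conjugate stabilizer. -/
theorem mem_ptStab_singleton_apply {g h : M ≃[L] M} {a : M} :
    g ∈ ptStab L ({h a} : Set M) ↔ h⁻¹ * g * h ∈ ptStab L ({a} : Set M) := by
  rw [mem_ptStab_singleton, mem_ptStab_singleton, mul_apply, mul_apply, inv_apply]
  refine ⟨fun H => by rw [H, h.symm_apply_apply], fun H => ?_⟩
  rw [← h.apply_symm_apply (g (h a)), H]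

/-- If in `N` distinct points have distinct stabilizers, `F : Aut(M) ≅ Aut(N)`
is a group isomorphism, and `f : M → N` is a bijection with `F(Aut(M)_(a)) = Aut(N)_(f(a))`
for every `a`, then `F(h) = f ∘ h ∘ f⁻¹` for every `h ∈ Aut(M)`. -/
theorem statement_14 {L₁ L₂ : FirstOrder.Language} {M N : Type*}
    [L₁.Structure M] [L₂.Structure N]
    (hinj : Function.Injective fun b : N => ptStab L₂ ({b} : Set N))
    (F : (M ≃[L₁] M) ≃* (N ≃[L₂] N)) (f : M ≃ N)
    (hf : ∀ a : M, (ptStab L₁ ({a} : Set M)).map F.toMonoidHom = ptStab L₂ ({f a} : Set N)) :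
    ∀ (h : M ≃[L₁] M) (x : M), F h (f x) = f (h x) := by
  intro h x
  have key (g : M ≃[L₁] M) (a : M) :
      F g ∈ ptStab L₂ ({f a} : Set N) ↔ g ∈ ptStab L₁ ({a} : Set M) := by
    rw [← hf a]
    exact Subgroup.mem_map_iff_mem F.injective
  refine hinj (Subgroup.ext fun k => ?_)
  obtain ⟨g, rfl⟩ := F.surjective k
  change F g ∈ ptStab L₂ {F h (f x)} ↔ F g ∈ ptStab L₂ {f (h x)}
  rw [mem_ptStab_singleton_apply, key, mem_ptStab_singleton_apply, ← key,
    map_mul, map_mul, map_inv]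

end PaperSSIP
end

section
/- Let M be a countable structure with locally finite algebraicity, G = Aut(M), A ⊆ M finite, and H a subgroup of G with G_(A) ≤ H ≤ G_{A}. Then G_(acl_M(A)) ≤ H ≤ G_{acl_M(A)}. -/
open FirstOrder Cardinal

namespace PaperSSIP

variable {L : FirstOrder.Language} {M : Type*} [L.Structure M]

theorem conj_mem_ptStab {A : Set M} {f g : M ≃[L] M} (hf : f ∈ setStab L A)
    (hg : g ∈ ptStab L A) : f⁻¹ * g * f ∈ ptStab L A := by
  intro x hx
  have hfA : f '' A = A := hf
  have hfx : f x ∈ A := hfA ▸ Set.mem_image_of_mem f hx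
  rw [mul_apply, mul_apply, hg _ hfx]
  exact f.symm_apply_apply x

theorem apply_mem_acl {A : Set M} {f : M ≃[L] M} (hf : f ∈ setStab L A) {a : M}
    (ha : a ∈ acl L A) : f a ∈ acl L A := by
  refine (Set.Finite.image f ha).subset ?_
  rintro _ ⟨g, hg, rfl⟩
  exact ⟨_, ⟨f⁻¹ * g * f, conj_mem_ptStab hf hg, rfl⟩, f.apply_symm_apply (g (f a))⟩

theorem setStab_le_setStab_acl (A : Set M) : setStab L A ≤ setStab L (acl L A) := by
  intro f hf
  refine Set.Subset.antisymm (Set.image_subset_iff.2 fun a ha => apply_mem_acl hf ha) ?_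
  exact fun a ha => ⟨f⁻¹ a, apply_mem_acl (inv_mem hf) ha, f.apply_symm_apply a⟩

/-- If `A ⊆ M` is finite and `G_(A) ≤ H ≤ G_{A}`, then
`G_(acl(A)) ≤ H ≤ G_{acl(A)}`. -/
theorem statement_16 {L : FirstOrder.Language} {M : Type*} [L.Structure M]
    [Countable M] [Countable L.Symbols]
    (hlf : LocFinAlg L M) (A : Set M) (hA : A.Finite)
    (H : Subgroup (M ≃[L] M))
    (h1 : ptStab L A ≤ H) (h2 : H ≤ setStab L A) :
    ptStab L (acl L A) ≤ H ∧ H ≤ setStab L (acl L A) := by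
  exact ⟨(ptStab_anti (subset_acl A)).trans h1, h2.trans (setStab_le_setStab_acl A)⟩

end PaperSSIP
end
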